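/- Let g be a finite-dimensional real Lie algebra whose Killing form is negative definite (i.e., g is semisimple of compact type). For z ∈ g let k_z = { a ∈ g : [a, z] = 0 } be the centralizer of z and let m_z be the orthogonal complement of k_z in g with respect to the Killing form. If a ∈ m_z satisfies sin(ad a)(z) = 0, where sin(ad a) = ∑_{n≥0} (−1)ⁿ (ad a)^{2n+1}/(2n+1)! ∈ End(g), then a = 0. (Equivalently, in the complexification g^ℂ one has exp(i·ad(m_z))(z) ∩ g = {z}.) -/

import Mathlib

noncomputable section

/-- Let `g` be a finite-dimensional real Lie algebra with negative
definite Killing form. For `z ∈ g`, if `a` is orthogonal (for the Killing form) to the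
centralizer of `z` and `sin(ad a)(z) = 0` — the series
`∑ (−1)ⁿ (ad a)^{2n+1}/(2n+1)!` applied to `z`, its convergence (automatic in finite
dimension) expressed through all linear functionals — then `a = 0`. -/
theorem statement19 (g : Type*) [LieRing g] [LieAlgebra ℝ g] [FiniteDimensional ℝ g]
    (hneg : ∀ x : g, x ≠ 0 → killingForm ℝ g x x < 0)
    (z a : g)
    (ha : ∀ b : g, ⁅b, z⁆ = 0 → killingForm ℝ g a b = 0)
    (hsin : ∀ φ : Module.Dual ℝ g, HasSum
      (fun n : ℕ => φ (((-1 : ℝ) ^ n / (Nat.factorial (2 * n + 1) : ℝ)) •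
        ((LieAlgebra.ad ℝ g a) ^ (2 * n + 1)) z)) 0) :
    a = 0 := by
  have hsk : ∀ x y : g, killingForm ℝ g x ⁅a, y⁆ = - killingForm ℝ g ⁅a, x⁆ y := by
    intro x y
    have h1 := LieModule.traceForm_apply_lie_apply' ℝ g g a x y
    exact (neg_eq_iff_eq_neg.mpr h1).symm
  have hpow : ∀ (n : ℕ) (x y : g), killingForm ℝ g x (((LieAlgebra.ad ℝ g a) ^ n) y)
      = (-1) ^ n * killingForm ℝ g (((LieAlgebra.ad ℝ g a) ^ n) x) y := by
    intro n
    induction n with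
    | zero => intro x y; simp
    | succ k ih =>
      intro x y
      rw [pow_succ', Module.End.mul_apply, LieAlgebra.ad_apply, hsk, ih, ← pow_succ',
        pow_succ (LieAlgebra.ad ℝ g a) k, Module.End.mul_apply, LieAlgebra.ad_apply]
      ring
  have hnp : ∀ x : g, killingForm ℝ g x x ≤ 0 := by
    intro x
    by_cases hx : x = 0
    · simp [hx]
    · exact (hneg x hx).le
  have hs := (hsin (killingForm ℝ g ⁅a, z⁆)).neg
  have hterm : ∀ n : ℕ, -(killingForm ℝ g ⁅a, z⁆ (((-1 : ℝ) ^ n / (Nat.factorial (2 * n + 1) : ℝ)) •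
        ((LieAlgebra.ad ℝ g a) ^ (2 * n + 1)) z)) =
      -(killingForm ℝ g (((LieAlgebra.ad ℝ g a) ^ (n + 1)) z)
        (((LieAlgebra.ad ℝ g a) ^ (n + 1)) z)) / (Nat.factorial (2 * n + 1) : ℝ) := by
    intro n
    have e : 2 * n + 1 = n + (n + 1) := by ring
    have h1 : ((LieAlgebra.ad ℝ g a) ^ (2 * n + 1)) z
        = ((LieAlgebra.ad ℝ g a) ^ n) (((LieAlgebra.ad ℝ g a) ^ (n + 1)) z) := by
      rw [e, pow_add, Module.End.mul_apply]
    have h2 : ((LieAlgebra.ad ℝ g a) ^ n) ⁅a, z⁆ = ((LieAlgebra.ad ℝ g a) ^ (n + 1)) z := by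
      rw [pow_succ, Module.End.mul_apply, LieAlgebra.ad_apply]
    have h3 : ((-1 : ℝ) ^ n) * (-1) ^ n = 1 := by
      rw [← mul_pow]; simp
    rw [map_smul, h1, hpow, h2, smul_eq_mul]
    linear_combination (-(killingForm ℝ g (((LieAlgebra.ad ℝ g a) ^ (n + 1)) z)
        (((LieAlgebra.ad ℝ g a) ^ (n + 1)) z)) / (Nat.factorial (2 * n + 1) : ℝ)) * h3
  simp only [hterm, neg_zero] at hs
  have hz := (hasSum_zero_iff_of_nonneg (fun n => by
    have := hnp (((LieAlgebra.ad ℝ g a) ^ (n + 1)) z)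
    exact div_nonneg (by linarith) (by positivity))).1 hs
  have h0 := congrFun hz 0
  simp at h0
  have hz0 : ⁅a, z⁆ = 0 := by
    by_contra h
    exact (hneg _ h).ne h0
  by_contra h
  exact (hneg a h).ne (ha a hz0)
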